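/- (Continuous-time tracking bound.) Suppose there exist δ, β, η, ε > 0 such that β^{-1} σ_η < δ γ(δ,η,ε) − √η ε M_λ. Let ẑ be a Lipschitz solution of the regularized primal-dual gradient flow with ‖ẑ(0) − z*(0)‖_η < δ. Then for all t ∈ [0,S]: ‖ẑ(t) − z*(t)‖_η ≤ (β^{-1} σ_η + √η ε M_λ)/γ(δ,η,ε) + e^{−β γ(δ,η,ε) t} ( ‖ẑ(0) − z*(0)‖_η − (β^{-1} σ_η + √η ε M_λ)/γ(δ,η,ε) ). -/

import Mathlib

open Set Metric MeasureTheory Filter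
open scoped RealInnerProductSpace Topology

noncomputable section

namespace TVOpt

/-- Euclidean space `ℝ^d`. -/
abbrev E (d : ℕ) := EuclideanSpace ℝ (Fin d)

/-- Normal cone of a (convex) set `C` at a point `x`. -/
def normalCone {d : ℕ} (C : Set (E d)) (x : E d) : Set (E d) :=
  {y | ∀ w ∈ C, ⟪y, w - x⟫ ≤ 0}

/-- The nonnegative orthant `ℝ^m_+`. -/
def orthant (m : ℕ) : Set (E m) := {v | ∀ i, 0 ≤ v i}

/-- `p` is the Euclidean metric projection of `v` onto `C`. -/
def IsProjection {d : ℕ} (C : Set (E d)) (v p : E d) : Prop :=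
  p ∈ C ∧ ∀ w ∈ C, dist v p ≤ dist v w

/-- The `η`-weighted norm `‖(x,λ)‖_η = sqrt(‖x‖² + η⁻¹‖λ‖²)`. -/
def etaNorm {n m : ℕ} (η : ℝ) (z : E n × E m) : ℝ :=
  Real.sqrt (‖z.1‖ ^ 2 + η⁻¹ * ‖z.2‖ ^ 2)

variable {n m : ℕ}

/-- Maximal speed `σ_η` of a trajectory on `[0,S]`. -/
def sigmaEta (S : ℝ) (zstar : ℝ → E n × E m) (η : ℝ) : ℝ :=
  ⨆ p : {q : ℝ × ℝ // q.1 ∈ Icc 0 S ∧ q.2 ∈ Icc 0 S ∧ q.1 ≠ q.2},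
    etaNorm η (zstar p.1.2 - zstar p.1.1) / |p.1.2 - p.1.1|

/-- `M_λ = sup_{t ∈ [0,S]} ‖λ*(t) − λ_prior‖`. -/
def Mlam (S : ℝ) (ls : ℝ → E m) (lamprior : E m) : ℝ :=
  ⨆ t : Icc (0:ℝ) S, ‖ls t.1 - lamprior‖

/-- `M_nc(δ)`:  sup of the second-derivative norm of `f^nc` near the trajectory. -/
def Mnc (S : ℝ) (fnc : E n → ℝ → E m) (xs : ℝ → E n) (δ : ℝ) : ℝ :=
  ⨆ p : {q : ℝ × E n // q.1 ∈ Icc 0 S ∧ ‖q.2‖ ≤ δ},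
    ‖fderiv ℝ (fderiv ℝ (fun x => fnc x p.1.1)) (xs p.1.1 + p.1.2)‖

/-- `M_c(δ)`:  sup of the second-derivative norm of `f^c` near the trajectory. -/
def Mcc (S : ℝ) (fc : E n → ℝ → E m) (xs : ℝ → E n) (δ : ℝ) : ℝ :=
  ⨆ p : {q : ℝ × E n // q.1 ∈ Icc 0 S ∧ ‖q.2‖ ≤ δ},
    ‖fderiv ℝ (fderiv ℝ (fun x => fc x p.1.1)) (xs p.1.1 + p.1.2)‖

/-- `L_f(δ)`: sup of the Jacobian operator norm of `f` near the trajectory. -/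
def Lf (S : ℝ) (f : E n → ℝ → E m) (xs : ℝ → E n) (δ : ℝ) : ℝ :=
  ⨆ p : {q : ℝ × E n // q.1 ∈ Icc 0 S ∧ ‖q.2‖ ≤ δ},
    ‖fderiv ℝ (fun x => f x p.1.1) (xs p.1.1 + p.1.2)‖

/-- `sup_{t∈[0,S]} ‖λ*(t)‖`. -/
def supLam (S : ℝ) (ls : ℝ → E m) : ℝ := ⨆ t : Icc (0:ℝ) S, ‖ls t.1‖

/-- `D(δ,η) = √η L_f(δ) + M_c(δ) sup_t ‖λ*(t)‖`. -/
def Dconst (S : ℝ) (fc fnc : E n → ℝ → E m) (xs : ℝ → E n) (ls : ℝ → E m) (δ η : ℝ) : ℝ :=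
  Real.sqrt η * Lf S (fun x t => fc x t + fnc x t) xs δ + Mcc S fc xs δ * supLam S ls

/-- Hessian of a scalar function, as a linear operator on `ℝ^d`. -/
def hessOp {d : ℕ} (g : E d → ℝ) (x : E d) : E d →L[ℝ] E d :=
  fderiv ℝ (gradient g) x

/-- Nonconvex part of the Lagrangian, `ℒ^nc(x,λ,t) = c(x,t) + λᵀ f^nc(x,t)`. -/
def Lnc (c : E n → ℝ → ℝ) (fnc : E n → ℝ → E m) (x : E n) (lam : E m) (t : ℝ) : ℝ :=
  c x t + ⟪lam, fnc x t⟫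

/-- Averaged Hessian `H̄_{ℒ^nc}(u,t)`. -/
def HbarL (c : E n → ℝ → ℝ) (fnc : E n → ℝ → E m) (xs : ℝ → E n) (ls : ℝ → E m)
    (u : E n) (t : ℝ) : E n →L[ℝ] E n :=
  ∫ θ in (0:ℝ)..1, hessOp (fun x => Lnc c fnc x (ls t) t) (xs t + θ • u)

/-- Averaged Hessian `H̄_{f^c_i}(u,t)`. -/
def Hbarfc (fc : E n → ℝ → E m) (xs : ℝ → E n) (i : Fin m) (u : E n) (t : ℝ) :
    E n →L[ℝ] E n :=
  ∫ θ in (0:ℝ)..1, (2 * (1 - θ)) • hessOp (fun x => fc x t i) (xs t + θ • u)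

/-- `ρ^(P)(δ,α,η,ε)`. -/
def rhoP (S : ℝ) (c : E n → ℝ → ℝ) (fc fnc : E n → ℝ → E m) (xs : ℝ → E n) (ls : ℝ → E m)
    (δ α η ε : ℝ) : ℝ :=
  ⨆ p : {q : ℝ × E n // q.1 ∈ Icc 0 S ∧ ‖q.2‖ ≤ δ},
    ‖((1 : E n →L[ℝ] E n) - α • HbarL c fnc xs ls p.1.2 p.1.1) ^ 2
      - (α * (1 - η * α * ε)) • ∑ i, ls p.1.1 i • Hbarfc fc xs i p.1.2 p.1.1‖

/-- The contraction factor `ρ(δ,α,η,ε)`. -/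
def rho (S : ℝ) (c : E n → ℝ → ℝ) (fc fnc : E n → ℝ → E m) (xs : ℝ → E n) (ls : ℝ → E m)
    (δ α η ε : ℝ) : ℝ :=
  Real.sqrt (max (rhoP S c fc fnc xs ls δ α η ε) ((1 - η * α * ε) ^ 2)
    + α * (1 - η * α * ε) * (Real.sqrt η * δ * Mnc S fnc xs δ / 2)
    + α ^ 2 * (2 * (⨆ p : {q : ℝ × E n // q.1 ∈ Icc 0 S ∧ ‖q.2‖ ≤ δ},
          ‖(η * ε) • (1 : E n →L[ℝ] E n) - HbarL c fnc xs ls p.1.2 p.1.1‖)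
            * Dconst S fc fnc xs ls δ η
        + Dconst S fc fnc xs ls δ η ^ 2))

/-- The constant `κ(δ,α,η,ε)`. -/
def kappa (S : ℝ) (c : E n → ℝ → ℝ) (fc fnc : E n → ℝ → E m) (xs : ℝ → E n) (ls : ℝ → E m)
    (δ α η ε : ℝ) : ℝ :=
  max 1 (max ((1 - η * α * ε) / rho S c fc fnc xs ls δ α η ε)
    (Real.sqrt η * α * Lf S (fun x t => fc x t + fnc x t) xs δ
      / rho S c fc fnc xs ls δ α η ε))

/-- Smallest eigenvalue of a symmetric operator, `inf_{‖h‖=1} ⟪A h, h⟫`. -/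
def lambdaMin {d : ℕ} (A : E d →L[ℝ] E d) : ℝ :=
  ⨅ h : {h : E d // ‖h‖ = 1}, ⟪A h.1, h.1⟫

/-- `Λ_m(δ)`. -/
def LambdaM (S : ℝ) (c : E n → ℝ → ℝ) (fc fnc : E n → ℝ → E m) (xs : ℝ → E n)
    (ls : ℝ → E m) (δ : ℝ) : ℝ :=
  ⨅ p : {q : ℝ × E n // q.1 ∈ Icc 0 S ∧ ‖q.2‖ ≤ δ},
    lambdaMin (HbarL c fnc xs ls p.1.2 p.1.1
      + (2⁻¹ : ℝ) • ∑ i, ls p.1.1 i • Hbarfc fc xs i p.1.2 p.1.1)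

/-- `γ(δ,η,ε) = min{Λ_m(δ), ηε} − (√η/4) δ M_nc(δ)`. -/
def gammaC (S : ℝ) (c : E n → ℝ → ℝ) (fc fnc : E n → ℝ → E m) (xs : ℝ → E n)
    (ls : ℝ → E m) (δ η ε : ℝ) : ℝ :=
  min (LambdaM S c fc fnc xs ls δ) (η * ε) - Real.sqrt η / 4 * δ * Mnc S fnc xs δ

/-- The standing data and assumptions of the time-varying nonconvex problem. -/
structure Problem (n m : ℕ) where
  S : ℝ
  hS : 0 < S
  X : ℝ → Set (E n)
  c : E n → ℝ → ℝ
  fc : E n → ℝ → E m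
  fnc : E n → ℝ → E m
  hXne : ∀ t ∈ Icc 0 S, (X t).Nonempty
  hXcl : ∀ t ∈ Icc 0 S, IsClosed (X t)
  hXcv : ∀ t ∈ Icc 0 S, Convex ℝ (X t)
  hc : ∀ t ∈ Icc 0 S, ContDiff ℝ 2 fun x => c x t
  hfc : ∀ t ∈ Icc 0 S, ContDiff ℝ 2 fun x => fc x t
  hfnc : ∀ t ∈ Icc 0 S, ContDiff ℝ 2 fun x => fnc x t
  hcHess : ContinuousOn (fun p : E n × ℝ => fderiv ℝ (fderiv ℝ fun x => c x p.2) p.1)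
    (univ ×ˢ Icc 0 S)
  hfcHess : ∀ i : Fin m, ContinuousOn
    (fun p : E n × ℝ => fderiv ℝ (fderiv ℝ fun x => fc x p.2 i) p.1) (univ ×ˢ Icc 0 S)
  hfncHess : ∀ i : Fin m, ContinuousOn
    (fun p : E n × ℝ => fderiv ℝ (fderiv ℝ fun x => fnc x p.2 i) p.1) (univ ×ˢ Icc 0 S)
  hconv : ∀ t ∈ Icc 0 S, ∀ i : Fin m, ConvexOn ℝ univ fun x => fc x t i

/-- The full constraint function `f = f^c + f^nc`. -/
def Problem.f (P : Problem n m) : E n → ℝ → E m := fun x t => P.fc x t + P.fnc x t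

/-- The KKT conditions at time `t`. -/
def IsKKT (P : Problem n m) (t : ℝ) (x : E n) (lam : E m) : Prop :=
  x ∈ P.X t ∧ lam ∈ orthant m ∧
    -(gradient (fun y => P.c y t) x
        + ContinuousLinearMap.adjoint (fderiv ℝ (fun y => P.f y t) x) lam)
      ∈ normalCone (P.X t) x ∧
    P.f x t ∈ normalCone (orthant m) lam

/-- A Lipschitz trajectory with values in `𝒳(t) × ℝ^m_+`. -/
def IsTraj (P : Problem n m) (xs : ℝ → E n) (ls : ℝ → E m) : Prop :=
  (∃ L : NNReal, LipschitzOnWith L (fun t => (xs t, ls t)) (Icc 0 P.S)) ∧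
    ∀ t ∈ Icc 0 P.S, xs t ∈ P.X t ∧ ls t ∈ orthant m

/-- A Lipschitz KKT trajectory. -/
def IsKKTTraj (P : Problem n m) (xs : ℝ → E n) (ls : ℝ → E m) : Prop :=
  IsTraj P xs ls ∧ ∀ t ∈ Icc 0 P.S, IsKKT P t (xs t) (ls t)

/-- One step of the regularized primal-dual gradient method at time `t`,
from `zp` to `zn`. -/
def IsRPDStep (P : Problem n m) (lamprior : E m) (α η ε t : ℝ)
    (zp zn : E n × E m) : Prop :=
  IsProjection (P.X t)
    (zp.1 - α • (gradient (fun x => P.c x t) zp.1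
      + ContinuousLinearMap.adjoint (fderiv ℝ (fun x => P.f x t) zp.1) zp.2)) zn.1 ∧
  IsProjection (orthant m)
    (zp.2 + (η * α) • (P.f zp.1 t - ε • (zp.2 - lamprior))) zn.2

/-- A Lipschitz solution of the regularized primal-dual gradient flow. -/
def IsFlowSol (P : Problem n m) (lamprior : E m) (β η ε : ℝ)
    (z : ℝ → E n × E m) : Prop :=
  (∃ L : NNReal, LipschitzOnWith L z (Icc 0 P.S)) ∧
  (∀ t ∈ Icc 0 P.S, (z t).1 ∈ P.X t ∧ (z t).2 ∈ orthant m) ∧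
  ∀ᵐ t ∂(volume.restrict (Icc 0 P.S)), ∃ dz : E n × E m, HasDerivAt z dz t ∧
    (-dz.1 - β • (gradient (fun x => P.c x t) (z t).1
        + ContinuousLinearMap.adjoint (fderiv ℝ (fun x => P.f x t) (z t).1) (z t).2)
      ∈ normalCone (P.X t) (z t).1) ∧
    (-dz.2 + (η * β) • (P.f (z t).1 t - ε • ((z t).2 - lamprior))
      ∈ normalCone (orthant m) (z t).2)


section Calculus

variable {d : ℕ} {g : E d → ℝ}

lemma contDiff_gradient (hg : ContDiff ℝ 2 g) : ContDiff ℝ 1 (gradient g) :=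
  (InnerProductSpace.toDual ℝ (E d)).symm.contDiff.comp
    (hg.fderiv_right (m := 1) (by norm_num))

lemma hasFDerivAt_gradient (hg : ContDiff ℝ 2 g) (y : E d) :
    HasFDerivAt (gradient g) (hessOp g y) y :=
  ((contDiff_gradient hg).differentiable (by norm_num) y).hasFDerivAt

lemma continuous_hessOp (hg : ContDiff ℝ 2 g) : Continuous (hessOp g) :=
  (contDiff_gradient hg).continuous_fderiv (by norm_num)

lemma hasDerivAt_line (x u : E d) (θ : ℝ) : HasDerivAt (fun θ : ℝ => x + θ • u) u θ := by
  simpa using ((hasDerivAt_id θ).smul_const u).const_add x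

lemma hasDerivAt_comp_line (hg : ContDiff ℝ 2 g) (x u : E d) (θ : ℝ) :
    HasDerivAt (fun θ : ℝ => g (x + θ • u)) ⟪gradient g (x + θ • u), u⟫ θ := by
  rw [inner_gradient_left]
  exact (hg.differentiable (by norm_num) _).hasFDerivAt.comp_hasDerivAt θ (hasDerivAt_line x u θ)

lemma hasDerivAt_inner_gradient_line (hg : ContDiff ℝ 2 g) (x u : E d) (θ : ℝ) :
    HasDerivAt (fun θ : ℝ => ⟪gradient g (x + θ • u), u⟫) ⟪hessOp g (x + θ • u) u, u⟫ θ := by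
  simpa using ((hasFDerivAt_gradient hg _).comp_hasDerivAt θ
    (hasDerivAt_line x u θ)).inner ℝ (hasDerivAt_const θ u)

lemma inner_integral_apply {A : ℝ → E d →L[ℝ] E d} (hA : Continuous A) (u : E d) :
    ⟪(∫ θ in (0 : ℝ)..1, A θ) u, u⟫ = ∫ θ in (0 : ℝ)..1, ⟪A θ u, u⟫ := by
  rw [ContinuousLinearMap.intervalIntegral_apply (hA.intervalIntegrable _ _), real_inner_comm]
  have h := (innerSL ℝ u).intervalIntegral_comp_comm (μ := volume) (a := 0) (b := 1)
    (f := fun θ => A θ u) ((hA.clm_apply continuous_const).intervalIntegrable _ _)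
  simp only [innerSL_apply_apply] at h
  rw [← h]
  simp only [real_inner_comm]

lemma continuous_hessOp_line (hg : ContDiff ℝ 2 g) (x u : E d) :
    Continuous fun θ : ℝ => hessOp g (x + θ • u) :=
  (continuous_hessOp hg).comp (by fun_prop)

lemma inner_integral_hessOp (hg : ContDiff ℝ 2 g) (x u : E d) :
    ⟪(∫ θ in (0 : ℝ)..1, hessOp g (x + θ • u)) u, u⟫
      = ⟪gradient g (x + u), u⟫ - ⟪gradient g x, u⟫ := by
  have hc := continuous_hessOp_line hg x u
  rw [inner_integral_apply hc, intervalIntegral.integral_eq_sub_of_hasDerivAt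
    (fun θ _ => hasDerivAt_inner_gradient_line hg x u θ)
    (((hc.clm_apply continuous_const).inner continuous_const).intervalIntegrable _ _)]
  simp

lemma inner_integral_weighted_hessOp (hg : ContDiff ℝ 2 g) (x u : E d) :
    ⟪(∫ θ in (0 : ℝ)..1, (2 * (1 - θ)) • hessOp g (x + θ • u)) u, u⟫
      = 2 * (g (x + u) - g x - ⟪gradient g x, u⟫) := by
  have hc : Continuous fun θ : ℝ => (2 * (1 - θ)) • hessOp g (x + θ • u) :=
    (by fun_prop : Continuous fun θ : ℝ => 2 * (1 - θ)).smul (continuous_hessOp_line hg x u)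
  have hd (θ : ℝ) : HasDerivAt
      (fun θ : ℝ => 2 * (1 - θ) * ⟪gradient g (x + θ • u), u⟫ + 2 * g (x + θ • u))
      ⟪((2 * (1 - θ)) • hessOp g (x + θ • u)) u, u⟫ θ := by
    have h1 : HasDerivAt (fun θ : ℝ => 2 * (1 - θ)) (-2) θ := by
      simpa using ((hasDerivAt_id θ).const_sub 1).const_mul 2
    refine ((h1.mul (hasDerivAt_inner_gradient_line hg x u θ)).add
      ((hasDerivAt_comp_line hg x u θ).const_mul 2)).congr_deriv ?_
    rw [smul_apply, real_inner_smul_left]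
    ring
  rw [inner_integral_apply hc, intervalIntegral.integral_eq_sub_of_hasDerivAt (fun θ _ => hd θ)
    (((hc.clm_apply continuous_const).inner continuous_const).intervalIntegrable _ _)]
  simp
  ring

lemma sub_le_inner_gradient (hg : ContDiff ℝ 2 g) (hcv : ConvexOn ℝ univ g) (x u : E d) :
    g (x + u) - g x ≤ ⟪gradient g (x + u), u⟫ := by
  have hφ : ConvexOn ℝ univ fun θ : ℝ => g (x + θ • u) := by
    have := hcv.comp_affineMap (AffineMap.lineMap x (x + u))
    simpa [Function.comp_def, AffineMap.lineMap_apply, add_comm] using this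
  have h := hφ.slope_le_of_hasDerivAt (mem_univ 0) (mem_univ 1) one_pos
    (hasDerivAt_comp_line hg x u 1)
  simpa [slope] using h

lemma norm_fderiv_apply_sub_le {m : ℕ} {G : E d → E m} (hG : ContDiff ℝ 2 G) {x u : E d}
    {δ M : ℝ} (hM : ∀ v : E d, ‖v‖ ≤ δ → ‖fderiv ℝ (fderiv ℝ G) (x + v)‖ ≤ M) (hu : ‖u‖ ≤ δ) :
    ‖fderiv ℝ G (x + u) u - (G (x + u) - G x)‖ ≤ M / 2 * ‖u‖ ^ 2 := by
  have hG1 : ContDiff ℝ 1 (fderiv ℝ G) := hG.fderiv_right (by norm_num)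
  have hd (θ : ℝ) : HasDerivAt
      (fun θ : ℝ => θ • fderiv ℝ G (x + θ • u) u - (G (x + θ • u) - G x))
      (θ • fderiv ℝ (fderiv ℝ G) (x + θ • u) u u) θ := by
    have h1 : HasDerivAt (fun θ : ℝ => fderiv ℝ G (x + θ • u) u)
        (fderiv ℝ (fderiv ℝ G) (x + θ • u) u u) θ :=
      (ContinuousLinearMap.apply ℝ (E m) u).hasFDerivAt.comp_hasDerivAt θ
        ((hG1.differentiable (by norm_num) (x + θ • u)).hasFDerivAt.comp_hasDerivAt θ
          (hasDerivAt_line x u θ))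
    have h2 : HasDerivAt (fun θ : ℝ => G (x + θ • u)) (fderiv ℝ G (x + θ • u) u) θ :=
      (hG.differentiable (by norm_num) _).hasFDerivAt.comp_hasDerivAt θ (hasDerivAt_line x u θ)
    refine ((hasDerivAt_id θ).smul h1).sub (h2.sub_const (G x)) |>.congr_deriv ?_
    simp
  have h := image_norm_le_of_norm_deriv_right_le_deriv_boundary (a := 0) (b := 1)
    (fun θ _ => (hd θ).continuousAt.continuousWithinAt) (fun θ _ => (hd θ).hasDerivWithinAt)
    (B := fun θ => M / 2 * ‖u‖ ^ 2 * θ ^ 2) (B' := fun θ => M * ‖u‖ ^ 2 * θ) (by simp)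
    (fun θ => by
      refine ((hasDerivAt_pow 2 θ).const_mul (M / 2 * ‖u‖ ^ 2)).congr_deriv ?_
      push_cast
      ring)
    (fun θ hθ => by
      have hθu : ‖θ • u‖ ≤ δ := by
        rw [norm_smul, Real.norm_of_nonneg hθ.1]
        exact (mul_le_of_le_one_left (norm_nonneg u) hθ.2.le).trans hu
      rw [norm_smul, Real.norm_of_nonneg hθ.1, mul_comm]
      refine mul_le_mul_of_nonneg_right ?_ hθ.1
      calc ‖fderiv ℝ (fderiv ℝ G) (x + θ • u) u u‖
          ≤ ‖fderiv ℝ (fderiv ℝ G) (x + θ • u)‖ * ‖u‖ * ‖u‖ :=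
            ContinuousLinearMap.le_opNorm₂ _ _ _
        _ ≤ M * ‖u‖ * ‖u‖ := by gcongr; exact hM _ hθu
        _ = M * ‖u‖ ^ 2 := by ring)
    (right_mem_Icc.2 zero_le_one)
  simpa using h

lemma lambdaMin_mul_norm_sq_le (A : E d →L[ℝ] E d) (u : E d) :
    lambdaMin A * ‖u‖ ^ 2 ≤ ⟪A u, u⟫ := by
  rcases eq_or_ne u 0 with rfl | hu
  · simp
  have hu' : ‖u‖ ≠ 0 := norm_ne_zero_iff.2 hu
  have hbdd : BddBelow (range fun h : {h : E d // ‖h‖ = 1} => ⟪A h.1, h.1⟫) := by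
    refine ⟨-‖A‖, ?_⟩
    rintro _ ⟨⟨h, hh⟩, rfl⟩
    have h1 := (abs_real_inner_le_norm (A h) h).trans
      (mul_le_mul_of_nonneg_right (A.le_opNorm h) (norm_nonneg h))
    rw [hh, mul_one, mul_one] at h1
    exact (abs_le.1 h1).1
  have h := ciInf_le hbdd ⟨‖u‖⁻¹ • u, by rw [norm_smul, norm_inv, norm_norm, inv_mul_cancel₀ hu']⟩
  simp only [map_smul, real_inner_smul_left, real_inner_smul_right] at h
  calc lambdaMin A * ‖u‖ ^ 2 ≤ ‖u‖⁻¹ * (‖u‖⁻¹ * ⟪A u, u⟫) * ‖u‖ ^ 2 := by gcongr; exact h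
    _ = ⟪A u, u⟫ := by field_simp

lemma fderiv_euclidean_apply {m : ℕ} {G : E d → E m} {x : E d} (hG : DifferentiableAt ℝ G x)
    (i : Fin m) : fderiv ℝ (fun y => G y i) x = (EuclideanSpace.proj i).comp (fderiv ℝ G x) :=
  ((EuclideanSpace.proj i : E m →L[ℝ] ℝ).hasFDerivAt.comp x hG.hasFDerivAt).fderiv

lemma norm_le_sum_norm_apply {m : ℕ} (v : E m) : ‖v‖ ≤ ∑ i, ‖v i‖ := by
  rw [EuclideanSpace.norm_eq]
  exact Real.sqrt_le_iff.2 ⟨Finset.sum_nonneg fun i _ => norm_nonneg _,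
    Finset.sum_sq_le_sq_sum_of_nonneg fun i _ => norm_nonneg _⟩

lemma norm_fderiv_fderiv_le_sum {m : ℕ} {G : E d → E m} (hG : ContDiff ℝ 2 G) (x : E d) :
    ‖fderiv ℝ (fderiv ℝ G) x‖ ≤ ∑ i, ‖fderiv ℝ (fderiv ℝ fun y => (G y i : ℝ)) x‖ := by
  refine ContinuousLinearMap.opNorm_le_bound₂ _
    (Finset.sum_nonneg fun i _ => norm_nonneg (fderiv ℝ (fderiv ℝ fun y => G y i) x))
    fun h k => (norm_le_sum_norm_apply _).trans ?_
  rw [Finset.sum_mul, Finset.sum_mul]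
  refine Finset.sum_le_sum fun i _ => ?_
  have hG1 : ContDiff ℝ 1 (fderiv ℝ G) := hG.fderiv_right (by norm_num)
  have e : fderiv ℝ (fderiv ℝ fun y => (G y i : ℝ)) x h k = fderiv ℝ (fderiv ℝ G) x h k i := by
    have e1 : (fderiv ℝ fun y => (G y i : ℝ))
        = fun y => (EuclideanSpace.proj i : E m →L[ℝ] ℝ).comp (fderiv ℝ G y) :=
      funext fun y => fderiv_euclidean_apply (hG.differentiable (by norm_num) y) i
    rw [e1, fderiv_clm_comp (differentiableAt_const _) (hG1.differentiable (by norm_num) x)]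
    simp
  rw [← e]
  exact ContinuousLinearMap.le_opNorm₂ _ _ _

end Calculus

section Comparison

lemma le_add_of_ae_deriv_nonpos {U : ℝ → ℝ} {a b : ℝ} (hab : a ≤ b)
    (hU : AbsolutelyContinuousOnInterval U a b)
    (hd : ∀ᵐ s, s ∈ Ioo a b → deriv U s ≤ 0) : U b ≤ U a := by
  have h := hU.integral_deriv_eq_sub
  have h' : ∫ s in a..b, deriv U s ≤ 0 := by
    rw [intervalIntegral.integral_of_le hab, integral_Ioc_eq_integral_Ioo]
    exact setIntegral_nonpos_ae measurableSet_Ioo hd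
  linarith

lemma tracking_of_ae_deriv_le {V : ℝ → ℝ} {S k r δ : ℝ} (hk : 0 ≤ k) {L : NNReal}
    (hV : LipschitzOnWith L V (Icc 0 S)) (h0 : V 0 < δ) (hr : r < δ)
    (hd : ∀ᵐ s, s ∈ Ioo 0 S → DifferentiableAt ℝ V s → V s ≤ δ → deriv V s ≤ -k * (V s - r)) :
    ∀ t ∈ Icc 0 S, V t ≤ r + Real.exp (-k * t) * (V 0 - r) := by
  have key : ∀ t ∈ Icc 0 S, (∀ s ∈ Ioo 0 t, V s ≤ δ) →
      V t ≤ r + Real.exp (-k * t) * (V 0 - r) := by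
    intro t ht hs
    have hsub : uIcc 0 t ⊆ Icc 0 S := by
      rw [uIcc_of_le ht.1]
      exact Icc_subset_Icc_right ht.2
    have hVac : AbsolutelyContinuousOnInterval V 0 t :=
      (hV.mono hsub).absolutelyContinuousOnInterval
    have hVr : AbsolutelyContinuousOnInterval (fun s => V s - r) 0 t :=
      ((LipschitzWith.id.sub (LipschitzWith.const r)).comp_lipschitzOnWith
        (hV.mono hsub)).absolutelyContinuousOnInterval
    have hexp : AbsolutelyContinuousOnInterval (fun s => Real.exp (k * s)) 0 t :=
      ContDiffOn.absolutelyContinuousOnInterval (by fun_prop)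
    have hle := le_add_of_ae_deriv_nonpos ht.1 (hexp.mul hVr) (by
      filter_upwards [hVac.ae_differentiableAt, hd] with s hs1 hs2 hst
      have hdiff := hs1 (by rw [uIcc_of_le ht.1]; exact Ioo_subset_Icc_self hst)
      have hdle := hs2 ⟨hst.1, hst.2.trans_le ht.2⟩ hdiff (hs s hst)
      have he : HasDerivAt (fun s => Real.exp (k * s)) (Real.exp (k * s) * k) s := by
        simpa using ((hasDerivAt_id s).const_mul k).exp
      rw [(he.mul (hdiff.hasDerivAt.sub_const r)).deriv]
      nlinarith [Real.exp_pos (k * s)])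
    simp only [Pi.mul_apply, mul_zero, Real.exp_zero, one_mul] at hle
    have hmul := mul_le_mul_of_nonneg_left hle (Real.exp_pos (-k * t)).le
    rw [← mul_assoc, ← Real.exp_add, show -k * t + k * t = 0 by ring, Real.exp_zero,
      one_mul] at hmul
    linarith
  have hlt : ∀ t ∈ Icc 0 S, V t < δ := by
    by_contra! hne
    obtain ⟨t, ht, htδ⟩ := hne
    have hcl : IsClosed (Icc 0 S ∩ V ⁻¹' Ici δ) :=
      hV.continuousOn.preimage_isClosed_of_isClosed isClosed_Icc isClosed_Ici
    have hbdd : BddBelow (Icc 0 S ∩ V ⁻¹' Ici δ) := ⟨0, fun s hs => hs.1.1⟩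
    obtain ⟨hmem, hδ⟩ := hcl.csInf_mem ⟨t, ht, htδ⟩ hbdd
    have hV1 := key _ hmem fun s hs => by
      by_contra! hsδ
      exact hs.2.not_ge (csInf_le hbdd ⟨⟨hs.1.le, hs.2.le.trans hmem.2⟩, hsδ.le⟩)
    have hexp1 : Real.exp (-k * sInf (Icc 0 S ∩ V ⁻¹' Ici δ)) ≤ 1 :=
      Real.exp_le_one_iff.2 (by nlinarith [mul_nonneg hk hmem.1])
    have hexp0 := Real.exp_pos (-k * sInf (Icc 0 S ∩ V ⁻¹' Ici δ))
    have hδ' : δ ≤ V (sInf (Icc 0 S ∩ V ⁻¹' Ici δ)) := hδ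
    generalize Real.exp (-k * sInf (Icc 0 S ∩ V ⁻¹' Ici δ)) = e at *
    rcases le_total (V 0) r with h | h <;> nlinarith
  exact fun t ht => key t ht fun s hs => (hlt s ⟨hs.1.le, hs.2.le.trans ht.2⟩).le

lemma hasDerivAt_le_of_eventually_le_right {a b : ℝ → ℝ} {a' b' t : ℝ} (ha : HasDerivAt a a' t)
    (hb : HasDerivAt b b' t) (hab : a t = b t) (hle : ∀ᶠ s in 𝓝[>] t, a s ≤ b s) :
    a' ≤ b' := by
  have h1 := (hasDerivWithinAt_iff_tendsto_slope' self_notMem_Ioi).1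
    (ha.hasDerivWithinAt (s := Ioi t))
  have h2 := (hasDerivWithinAt_iff_tendsto_slope' self_notMem_Ioi).1
    (hb.hasDerivWithinAt (s := Ioi t))
  refine le_of_tendsto_of_tendsto h1 h2 ?_
  filter_upwards [hle, self_mem_nhdsWithin] with s hs hst
  have : 0 < s - t := sub_pos.2 hst
  simp only [slope_def_field, hab]
  gcongr

end Comparison

section EtaNorm

variable {n m : ℕ}

lemma etaNorm_nonneg (η : ℝ) (z : E n × E m) : 0 ≤ etaNorm η z := Real.sqrt_nonneg _

lemma etaNorm_sq {η : ℝ} (hη : 0 < η) (z : E n × E m) :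
    etaNorm η z ^ 2 = ‖z.1‖ ^ 2 + η⁻¹ * ‖z.2‖ ^ 2 := Real.sq_sqrt (by positivity)

/-- The linear map into an `L²` product that turns the weighted norm into the standard one. -/
def etaMap (n m : ℕ) (η : ℝ) : E n × E m →L[ℝ] WithLp 2 (E n × E m) :=
  ((WithLp.prodContinuousLinearEquiv 2 ℝ (E n) (E m)).symm : _ →L[ℝ] _).comp
    ((ContinuousLinearMap.id ℝ (E n)).prodMap ((√η)⁻¹ • ContinuousLinearMap.id ℝ (E m)))

lemma etaNorm_eq {η : ℝ} (hη : 0 < η) (z : E n × E m) : etaNorm η z = ‖etaMap n m η z‖ := by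
  rw [WithLp.prod_norm_eq_of_L2, etaNorm]
  congr 2
  change _ = ‖(√η)⁻¹ • z.2‖ ^ 2
  rw [norm_smul, mul_pow, norm_inv, Real.norm_of_nonneg (Real.sqrt_nonneg η), inv_pow,
    Real.sq_sqrt hη.le]

lemma etaNorm_add_le {η : ℝ} (hη : 0 < η) (z w : E n × E m) :
    etaNorm η (z + w) ≤ etaNorm η z + etaNorm η w := by
  simp only [etaNorm_eq hη, map_add]
  exact norm_add_le _ _

lemma etaNorm_sub_comm {η : ℝ} (hη : 0 < η) (z w : E n × E m) :
    etaNorm η (z - w) = etaNorm η (w - z) := by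
  simp only [etaNorm_eq hη, map_sub]
  exact norm_sub_rev _ _

lemma norm_fst_le_etaNorm {η : ℝ} (hη : 0 < η) (z : E n × E m) : ‖z.1‖ ≤ etaNorm η z :=
  Real.le_sqrt_of_sq_le (by have : 0 ≤ η⁻¹ * ‖z.2‖ ^ 2 := by positivity
                            linarith)

lemma norm_snd_le_etaNorm {η : ℝ} (hη : 0 < η) (z : E n × E m) :
    ‖z.2‖ ≤ √η * etaNorm η z := by
  rw [etaNorm, ← Real.sqrt_mul hη.le]
  refine Real.le_sqrt_of_sq_le ?_
  rw [mul_add, mul_inv_cancel_left₀ hη.ne']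
  have : 0 ≤ η * ‖z.1‖ ^ 2 := by positivity
  linarith

lemma norm_fst_mul_norm_snd_le {η : ℝ} (hη : 0 < η) (z : E n × E m) :
    ‖z.1‖ * ‖z.2‖ ≤ √η / 2 * etaNorm η z ^ 2 := by
  rw [etaNorm_sq hη]
  have hs : 0 < √η := Real.sqrt_pos.2 hη
  have hη' : η⁻¹ = (√η)⁻¹ * (√η)⁻¹ := by rw [← mul_inv, Real.mul_self_sqrt hη.le]
  have h := mul_nonneg hs.le (sq_nonneg (‖z.1‖ - (√η)⁻¹ * ‖z.2‖))
  have hc : √η * (√η)⁻¹ = 1 := mul_inv_cancel₀ hs.ne'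
  rw [hη']
  linear_combination h / 2 - ‖z.1‖ * ‖z.2‖ * hc

lemma lipschitzOnWith_etaNorm {η : ℝ} (hη : 0 < η) {s : Set ℝ} {K : NNReal}
    {z : ℝ → E n × E m} (hz : LipschitzOnWith K z s) :
    LipschitzOnWith (1 * (‖etaMap n m η‖₊ * K)) (fun t => etaNorm η (z t)) s := by
  simp only [etaNorm_eq hη]
  exact lipschitzWith_one_norm.comp_lipschitzOnWith
    ((etaMap n m η).lipschitz.comp_lipschitzOnWith hz)

lemma hasDerivAt_etaNorm {η t : ℝ} (hη : 0 < η) {z : ℝ → E n × E m} {dz : E n × E m}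
    (hz : HasDerivAt z dz t) (h0 : 0 < etaNorm η (z t)) :
    HasDerivAt (fun s => etaNorm η (z s))
      ((⟪dz.1, (z t).1⟫ + η⁻¹ * ⟪dz.2, (z t).2⟫) / etaNorm η (z t)) t := by
  have h1 : HasDerivAt (fun s => (z s).1) dz.1 t := hz.fst
  have h2 : HasDerivAt (fun s => (z s).2) dz.2 t := hz.snd
  have h := (h1.norm_sq.add (h2.norm_sq.const_mul η⁻¹)).sqrt
    (Real.sqrt_pos.1 h0).ne'
  refine h.congr_deriv ?_
  change _ / (2 * etaNorm η (z t)) = _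
  rw [real_inner_comm dz.1, real_inner_comm dz.2]
  field_simp

lemma etaNorm_sub_le_sigmaEta {S η : ℝ} {zstar : ℝ → E n × E m}
    (hσ : 0 < sigmaEta S zstar η) {s t : ℝ} (hs : s ∈ Icc 0 S) (ht : t ∈ Icc 0 S) (hst : s < t) :
    etaNorm η (zstar t - zstar s) ≤ sigmaEta S zstar η * (t - s) := by
  have hbdd : BddAbove (range fun p : {q : ℝ × ℝ // q.1 ∈ Icc 0 S ∧ q.2 ∈ Icc 0 S ∧ q.1 ≠ q.2} =>
      etaNorm η (zstar p.1.2 - zstar p.1.1) / |p.1.2 - p.1.1|) := by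
    by_contra h
    exact hσ.ne' (Real.iSup_of_not_bddAbove h)
  have h := le_ciSup hbdd ⟨(s, t), hs, ht, hst.ne⟩
  rwa [div_le_iff₀ (abs_pos.2 (sub_pos.2 hst).ne'), abs_of_pos (sub_pos.2 hst)] at h

end EtaNorm

section Lagrangian

variable {n m : ℕ} (P : Problem n m) {xs : ℝ → E n} {ls : ℝ → E m}

/-- The gradient in `x` of the Lagrangian `c + λᵀ f` at time `t`. -/
def lagrangianGradient (t : ℝ) (x : E n) (lam : E m) : E n :=
  gradient (fun y => P.c y t) x
    + ContinuousLinearMap.adjoint (fderiv ℝ (fun y => P.f y t) x) lam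

variable {P} in
lemma inner_lagrangianGradient {t : ℝ} (ht : t ∈ Icc 0 P.S) (x u : E n) (lam : E m) :
    ⟪lagrangianGradient P t x lam, u⟫ = ⟪gradient (fun y => P.c y t) x, u⟫
      + ⟪lam, fderiv ℝ (fun y => P.fc y t) x u⟫ + ⟪lam, fderiv ℝ (fun y => P.fnc y t) x u⟫ := by
  have hf : fderiv ℝ (fun y => P.f y t) x
      = fderiv ℝ (fun y => P.fc y t) x + fderiv ℝ (fun y => P.fnc y t) x :=
    fderiv_fun_add ((P.hfc t ht).differentiable (by norm_num) x)
      ((P.hfnc t ht).differentiable (by norm_num) x)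
  rw [lagrangianGradient, inner_add_left, ContinuousLinearMap.adjoint_inner_left, hf,
    add_apply, inner_add_right, add_assoc]

lemma contDiff_Lnc {c : E n → ℝ → ℝ} {fnc : E n → ℝ → E m} {t : ℝ}
    (hc : ContDiff ℝ 2 fun x => c x t) (hf : ContDiff ℝ 2 fun x => fnc x t) (lam : E m) :
    ContDiff ℝ 2 fun x => Lnc c fnc x lam t :=
  hc.add (contDiff_const.inner ℝ hf)

lemma inner_gradient_Lnc {c : E n → ℝ → ℝ} {fnc : E n → ℝ → E m} {t : ℝ}
    (hc : ContDiff ℝ 2 fun x => c x t) (hf : ContDiff ℝ 2 fun x => fnc x t) (lam : E m)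
    (x u : E n) :
    ⟪gradient (fun x => Lnc c fnc x lam t) x, u⟫
      = ⟪gradient (fun x => c x t) x, u⟫ + ⟪lam, fderiv ℝ (fun x => fnc x t) x u⟫ := by
  have h : HasFDerivAt (fun x => Lnc c fnc x lam t)
      (fderiv ℝ (fun x => c x t) x + (innerSL ℝ lam).comp (fderiv ℝ (fun x => fnc x t) x)) x :=
    (hc.differentiable (by norm_num) x).hasFDerivAt.add
      ((innerSL ℝ lam).hasFDerivAt.comp x (hf.differentiable (by norm_num) x).hasFDerivAt)
  rw [inner_gradient_left, inner_gradient_left, h.fderiv]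
  simp

lemma inner_eq_sum_mul (v w : E m) : ⟪v, w⟫ = ∑ i, v i * w i := by
  simp [PiLp.inner_apply, mul_comm]

lemma bddAbove_norm_fderiv_fderiv_fnc (hxs : ContinuousOn xs (Icc 0 P.S)) (δ : ℝ) :
    BddAbove (range fun p : {q : ℝ × E n // q.1 ∈ Icc 0 P.S ∧ ‖q.2‖ ≤ δ} =>
      ‖fderiv ℝ (fderiv ℝ (fun x => P.fnc x p.1.1)) (xs p.1.1 + p.1.2)‖) := by
  have hK : IsCompact (Icc 0 P.S ×ˢ closedBall (0 : E n) δ) :=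
    isCompact_Icc.prod (isCompact_closedBall _ _)
  have hpath : ContinuousOn (fun q : ℝ × E n => (xs q.1 + q.2, q.1))
      (Icc 0 P.S ×ˢ closedBall (0 : E n) δ) :=
    ((hxs.comp continuousOn_fst fun q hq => hq.1).add continuousOn_snd).prodMk continuousOn_fst
  have hF : ContinuousOn (fun q : ℝ × E n =>
      ∑ i, ‖fderiv ℝ (fderiv ℝ fun x => P.fnc x q.1 i) (xs q.1 + q.2)‖)
      (Icc 0 P.S ×ˢ closedBall (0 : E n) δ) :=
    continuousOn_finsetSum _ fun i _ =>
      ContinuousOn.norm (E := E n →L[ℝ] E n →L[ℝ] ℝ)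
        ((P.hfncHess i).comp hpath fun q hq => ⟨mem_univ _, hq.1⟩)
  obtain ⟨C, hC⟩ := hK.bddAbove_image hF
  refine ⟨C, ?_⟩
  rintro _ ⟨⟨⟨t, v⟩, ht, hv⟩, rfl⟩
  exact (norm_fderiv_fderiv_le_sum (P.hfnc t ht) _).trans
    (hC ⟨(t, v), ⟨ht, mem_closedBall_zero_iff.2 hv⟩, rfl⟩)

variable {P} in
lemma norm_sub_prior_le_Mlam (hls : ContinuousOn ls (Icc 0 P.S)) (lamprior : E m) {t : ℝ}
    (ht : t ∈ Icc 0 P.S) : ‖ls t - lamprior‖ ≤ Mlam P.S ls lamprior := by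
  have hbdd : BddAbove (range fun t : Icc (0 : ℝ) P.S => ‖ls t.1 - lamprior‖) := by
    obtain ⟨C, hC⟩ := isCompact_Icc.bddAbove_image (hls.sub continuousOn_const).norm
    exact ⟨C, by rintro _ ⟨s, rfl⟩; exact hC ⟨s.1, s.2, rfl⟩⟩
  exact le_ciSup hbdd ⟨t, ht⟩

variable {P} in
lemma LambdaM_mul_norm_sq_le {δ : ℝ}
    (hΛ : 0 < LambdaM P.S P.c P.fc P.fnc xs ls δ) {t : ℝ} (ht : t ∈ Icc 0 P.S) {u : E n}
    (hu : ‖u‖ ≤ δ) :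
    LambdaM P.S P.c P.fc P.fnc xs ls δ * ‖u‖ ^ 2
      ≤ ⟪gradient (fun y => P.c y t) (xs t + u), u⟫ - ⟪gradient (fun y => P.c y t) (xs t), u⟫
        + ⟪ls t, fderiv ℝ (fun y => P.fnc y t) (xs t + u) u⟫
        - ⟪ls t, fderiv ℝ (fun y => P.fnc y t) (xs t) u⟫
        + ⟪ls t, P.fc (xs t + u) t - P.fc (xs t) t - fderiv ℝ (fun y => P.fc y t) (xs t) u⟫ := by
  have hbdd : BddBelow (range fun p : {q : ℝ × E n // q.1 ∈ Icc 0 P.S ∧ ‖q.2‖ ≤ δ} =>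
      lambdaMin (HbarL P.c P.fnc xs ls p.1.2 p.1.1
        + (2⁻¹ : ℝ) • ∑ i, ls p.1.1 i • Hbarfc P.fc xs i p.1.2 p.1.1)) := by
    by_contra h
    exact hΛ.ne' (Real.iInf_of_not_bddBelow h)
  have h1 := mul_le_mul_of_nonneg_right (ciInf_le hbdd ⟨(t, u), ht, hu⟩) (sq_nonneg ‖u‖)
  refine (h1.trans (lambdaMin_mul_norm_sq_le _ u)).trans_eq ?_
  have hfci (i : Fin m) : ContDiff ℝ 2 fun x => P.fc x t i := contDiff_euclidean.1 (P.hfc t ht) i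
  have hi (i : Fin m) : ⟪Hbarfc P.fc xs i u t u, u⟫ = 2 * (P.fc (xs t + u) t
      - P.fc (xs t) t - fderiv ℝ (fun y => P.fc y t) (xs t) u) i := by
    rw [Hbarfc, inner_integral_weighted_hessOp (hfci i), inner_gradient_left,
      fderiv_euclidean_apply ((P.hfc t ht).differentiable (by norm_num) _)]
    simp
  have hL : ⟪HbarL P.c P.fnc xs ls u t u, u⟫
      = ⟪gradient (fun y => P.c y t) (xs t + u), u⟫ - ⟪gradient (fun y => P.c y t) (xs t), u⟫
        + ⟪ls t, fderiv ℝ (fun y => P.fnc y t) (xs t + u) u⟫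
        - ⟪ls t, fderiv ℝ (fun y => P.fnc y t) (xs t) u⟫ := by
    rw [HbarL, inner_integral_hessOp (contDiff_Lnc (P.hc t ht) (P.hfnc t ht) _),
      inner_gradient_Lnc (P.hc t ht) (P.hfnc t ht), inner_gradient_Lnc (P.hc t ht) (P.hfnc t ht)]
    ring
  have hS : ⟪(∑ i, ls t i • Hbarfc P.fc xs i u t) u, u⟫ = 2 * ⟪ls t, P.fc (xs t + u) t
      - P.fc (xs t) t - fderiv ℝ (fun y => P.fc y t) (xs t) u⟫ := by
    rw [sum_apply, sum_inner, inner_eq_sum_mul, Finset.mul_sum]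
    refine Finset.sum_congr rfl fun i _ => ?_
    rw [smul_apply, real_inner_smul_left, hi]
    ring
  rw [add_apply, smul_apply, inner_add_left, real_inner_smul_left, hL, hS]
  ring

variable {P} in
lemma inner_fc_le {t : ℝ} (ht : t ∈ Icc 0 P.S) {lam : E m} (hlam : lam ∈ orthant m) (x u : E n) :
    ⟪lam, P.fc (x + u) t - P.fc x t⟫ ≤ ⟪lam, fderiv ℝ (fun y => P.fc y t) (x + u) u⟫ := by
  rw [inner_eq_sum_mul, inner_eq_sum_mul]
  refine Finset.sum_le_sum fun i _ => mul_le_mul_of_nonneg_left ?_ (hlam i)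
  have h := sub_le_inner_gradient (g := fun x => P.fc x t i)
    (contDiff_euclidean.1 (P.hfc t ht) i) (P.hconv t ht i) x u
  rw [inner_gradient_left,
    fderiv_euclidean_apply ((P.hfc t ht).differentiable (by norm_num) _)] at h
  simpa using h

variable {P} in
lemma LambdaM_sub_Mnc_le (hxs : ContinuousOn xs (Icc 0 P.S)) {δ : ℝ}
    (hΛ : 0 < LambdaM P.S P.c P.fc P.fnc xs ls δ) {t : ℝ} (ht : t ∈ Icc 0 P.S) {u : E n}
    (hu : ‖u‖ ≤ δ) {lam : E m} (hlam : lam ∈ orthant m) :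
    LambdaM P.S P.c P.fc P.fnc xs ls δ * ‖u‖ ^ 2
        - Mnc P.S P.fnc xs δ / 2 * ‖u‖ ^ 2 * ‖lam - ls t‖
      ≤ ⟪lagrangianGradient P t (xs t + u) lam, u⟫
        - ⟪lagrangianGradient P t (xs t) (ls t), u⟫
        - ⟪P.f (xs t + u) t - P.f (xs t) t, lam - ls t⟫ := by
  have h1 := LambdaM_mul_norm_sq_le hΛ ht hu
  have h2 := inner_fc_le ht hlam (xs t) u
  have h3 : ‖fderiv ℝ (fun y => P.fnc y t) (xs t + u) u - (P.fnc (xs t + u) t - P.fnc (xs t) t)‖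
      ≤ Mnc P.S P.fnc xs δ / 2 * ‖u‖ ^ 2 :=
    norm_fderiv_apply_sub_le (P.hfnc t ht)
      (fun v hv => le_ciSup (bddAbove_norm_fderiv_fderiv_fnc P hxs δ) ⟨(t, v), ht, hv⟩) hu
  have h4 := (neg_le_of_abs_le (abs_real_inner_le_norm (lam - ls t)
    (fderiv ℝ (fun y => P.fnc y t) (xs t + u) u - (P.fnc (xs t + u) t - P.fnc (xs t) t))))
  have h5 := mul_le_mul_of_nonneg_left h3 (norm_nonneg (lam - ls t))
  rw [inner_lagrangianGradient ht, inner_lagrangianGradient ht,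
    real_inner_comm (lam - ls t)]
  simp only [Problem.f, inner_sub_left, inner_sub_right, inner_add_right] at *
  linarith

end Lagrangian

section Tracking

variable {n m : ℕ} {P : Problem n m} {xs : ℝ → E n} {ls : ℝ → E m}

lemma gammaC_mul_sq_le (hxs : ContinuousOn xs (Icc 0 P.S)) {δ η ε : ℝ} (hδ : 0 < δ) (hη : 0 < η)
    (hγ : 0 < gammaC P.S P.c P.fc P.fnc xs ls δ η ε) {t : ℝ} (ht : t ∈ Icc 0 P.S)
    {u : E n} {lam : E m} (hlam : lam ∈ orthant m) (hu : etaNorm η (u, lam - ls t) ≤ δ) :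
    gammaC P.S P.c P.fc P.fnc xs ls δ η ε * etaNorm η (u, lam - ls t) ^ 2
      ≤ ⟪lagrangianGradient P t (xs t + u) lam, u⟫
        - ⟪lagrangianGradient P t (xs t) (ls t), u⟫
        - ⟪P.f (xs t + u) t - P.f (xs t) t, lam - ls t⟫ + ε * ‖lam - ls t‖ ^ 2 := by
  have hMnc : 0 ≤ Mnc P.S P.fnc xs δ :=
    Real.iSup_nonneg fun p =>
      norm_nonneg (fderiv ℝ (fderiv ℝ fun x => P.fnc x p.1.1) (xs p.1.1 + p.1.2))
  have hcoef : 0 ≤ √η / 4 * δ * Mnc P.S P.fnc xs δ := by positivity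
  have hmin : 0 < min (LambdaM P.S P.c P.fc P.fnc xs ls δ) (η * ε) := by
    rw [gammaC] at hγ
    linarith
  have hΛ := (lt_min_iff.1 hmin).1
  have huδ : ‖u‖ ≤ δ := (norm_fst_le_etaNorm hη (u, lam - ls t)).trans hu
  have h1 := LambdaM_sub_Mnc_le hxs hΛ ht huδ hlam
  have h2 : ‖u‖ * ‖lam - ls t‖ ≤ √η / 2 * etaNorm η (u, lam - ls t) ^ 2 :=
    norm_fst_mul_norm_snd_le hη (u, lam - ls t)
  have h3 : Mnc P.S P.fnc xs δ / 2 * ‖u‖ ^ 2 * ‖lam - ls t‖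
      ≤ √η / 4 * δ * Mnc P.S P.fnc xs δ * etaNorm η (u, lam - ls t) ^ 2 := by
    calc Mnc P.S P.fnc xs δ / 2 * ‖u‖ ^ 2 * ‖lam - ls t‖
        = Mnc P.S P.fnc xs δ / 2 * ‖u‖ * (‖u‖ * ‖lam - ls t‖) := by ring
      _ ≤ Mnc P.S P.fnc xs δ / 2 * δ * (√η / 2 * etaNorm η (u, lam - ls t) ^ 2) := by gcongr
      _ = _ := by ring
  have h4 : min (LambdaM P.S P.c P.fc P.fnc xs ls δ) (η * ε) * etaNorm η (u, lam - ls t) ^ 2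
      ≤ LambdaM P.S P.c P.fc P.fnc xs ls δ * ‖u‖ ^ 2 + ε * ‖lam - ls t‖ ^ 2 := by
    rw [etaNorm_sq hη]
    calc _ = min (LambdaM P.S P.c P.fc P.fnc xs ls δ) (η * ε) * ‖u‖ ^ 2
          + min (LambdaM P.S P.c P.fc P.fnc xs ls δ) (η * ε) * (η⁻¹ * ‖lam - ls t‖ ^ 2) := by
            rw [mul_add]
      _ ≤ LambdaM P.S P.c P.fc P.fnc xs ls δ * ‖u‖ ^ 2
          + η * ε * (η⁻¹ * ‖lam - ls t‖ ^ 2) := by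
            gcongr
            · exact min_le_left _ _
            · exact min_le_right _ _
      _ = _ := by field_simp
  rw [gammaC, sub_mul]
  linarith

lemma flow_inner_le (hxs : ContinuousOn xs (Icc 0 P.S)) (hls : ContinuousOn ls (Icc 0 P.S))
    {lamprior : E m} {δ β η ε : ℝ} (hδ : 0 < δ) (hβ : 0 < β) (hη : 0 < η) (hε : 0 < ε)
    (hγ : 0 < gammaC P.S P.c P.fc P.fnc xs ls δ η ε)
    {t : ℝ} (ht : t ∈ Icc 0 P.S) (hkkt : IsKKT P t (xs t) (ls t))
    {w dz : E n × E m} (hw : w.1 ∈ P.X t ∧ w.2 ∈ orthant m)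
    (hdx : -dz.1 - β • lagrangianGradient P t w.1 w.2 ∈ normalCone (P.X t) w.1)
    (hdl : -dz.2 + (η * β) • (P.f w.1 t - ε • (w.2 - lamprior)) ∈ normalCone (orthant m) w.2)
    (hwδ : etaNorm η (w - (xs t, ls t)) ≤ δ) :
    ⟪dz.1, w.1 - xs t⟫ + η⁻¹ * ⟪dz.2, w.2 - ls t⟫
      ≤ β * (√η * ε * Mlam P.S ls lamprior * etaNorm η (w - (xs t, ls t))
        - gammaC P.S P.c P.fc P.fnc xs ls δ η ε * etaNorm η (w - (xs t, ls t)) ^ 2) := by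
  obtain ⟨hxX, hlX, hkx, hkl⟩ := hkkt
  have h1 := gammaC_mul_sq_le (u := w.1 - xs t) hxs hδ hη hγ ht hw.2 hwδ
  have h2 : ⟪dz.1, w.1 - xs t⟫ ≤ -(β * ⟪lagrangianGradient P t w.1 w.2, w.1 - xs t⟫) := by
    have h := hdx _ hxX
    rw [← neg_sub w.1, inner_neg_right, inner_sub_left, inner_neg_left,
      real_inner_smul_left] at h
    linarith
  have h3 : η⁻¹ * ⟪dz.2, w.2 - ls t⟫
      ≤ β * (⟪P.f w.1 t, w.2 - ls t⟫ - ε * ⟪w.2 - lamprior, w.2 - ls t⟫) := by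
    have h := hdl _ hlX
    rw [← neg_sub w.2, inner_neg_right, inner_add_left, inner_neg_left,
      real_inner_smul_left, inner_sub_left, real_inner_smul_left] at h
    rw [inv_mul_le_iff₀ hη]
    linarith
  have h4 : 0 ≤ ⟪lagrangianGradient P t (xs t) (ls t), w.1 - xs t⟫ := by
    have h := hkx _ hw.1
    rw [inner_neg_left] at h
    exact neg_nonpos.1 h
  have h5 : ⟪P.f (xs t) t, w.2 - ls t⟫ ≤ 0 := hkl _ hw.2
  have h6 : ‖w.2 - ls t‖ ^ 2 - √η * Mlam P.S ls lamprior * etaNorm η (w - (xs t, ls t))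
      ≤ ⟪w.2 - lamprior, w.2 - ls t⟫ := by
    have e : w.2 - lamprior = (w.2 - ls t) + (ls t - lamprior) := by abel
    rw [e, inner_add_left, real_inner_self_eq_norm_sq]
    have ha := neg_le_of_abs_le (abs_real_inner_le_norm (ls t - lamprior) (w.2 - ls t))
    have hb : ‖ls t - lamprior‖ * ‖w.2 - ls t‖
        ≤ Mlam P.S ls lamprior * (√η * etaNorm η (w - (xs t, ls t))) :=
      mul_le_mul (norm_sub_prior_le_Mlam hls lamprior ht)
        (norm_snd_le_etaNorm hη (w - (xs t, ls t))) (norm_nonneg _)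
        (Real.iSup_nonneg fun _ => norm_nonneg _)
    linarith
  have h7 := mul_le_mul_of_nonneg_left h6 hε.le
  rw [add_sub_cancel, inner_sub_left] at h1
  have e : w - (xs t, ls t) = (w.1 - xs t, w.2 - ls t) := rfl
  rw [← e] at h1
  refine (add_le_add h2 h3).trans ?_
  rw [← mul_neg, ← mul_add]
  refine mul_le_mul_of_nonneg_left ?_ hβ.le
  linarith

lemma deriv_etaNorm_sub_le (hxs : ContinuousOn xs (Icc 0 P.S))
    (hls : ContinuousOn ls (Icc 0 P.S)) {lamprior : E m} {δ β η ε : ℝ} (hδ : 0 < δ)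
    (hβ : 0 < β) (hη : 0 < η) (hε : 0 < ε)
    (hσ : 0 < sigmaEta P.S (fun t => (xs t, ls t)) η)
    (hγ : 0 < gammaC P.S P.c P.fc P.fnc xs ls δ η ε)
    (hkkt : ∀ t ∈ Icc 0 P.S, IsKKT P t (xs t) (ls t)) {t : ℝ} (ht : t ∈ Ioo 0 P.S)
    {z : ℝ → E n × E m} {dz : E n × E m} (hw : (z t).1 ∈ P.X t ∧ (z t).2 ∈ orthant m)
    (hdz : HasDerivAt z dz t)
    (hdx : -dz.1 - β • lagrangianGradient P t (z t).1 (z t).2 ∈ normalCone (P.X t) (z t).1)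
    (hdl : -dz.2 + (η * β) • (P.f (z t).1 t - ε • ((z t).2 - lamprior))
      ∈ normalCone (orthant m) (z t).2)
    (hdiff : DifferentiableAt ℝ (fun s => etaNorm η (z s - (xs s, ls s))) t)
    (htδ : etaNorm η (z t - (xs t, ls t)) ≤ δ) :
    deriv (fun s => etaNorm η (z s - (xs s, ls s))) t
      ≤ -(β * gammaC P.S P.c P.fc P.fnc xs ls δ η ε) * (etaNorm η (z t - (xs t, ls t))
        - (β⁻¹ * sigmaEta P.S (fun t => (xs t, ls t)) η + √η * ε * Mlam P.S ls lamprior)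
          / gammaC P.S P.c P.fc P.fnc xs ls δ η ε) := by
  have htc := Ioo_subset_Icc_self ht
  have hM : 0 ≤ Mlam P.S ls lamprior := Real.iSup_nonneg fun _ => norm_nonneg _
  have hrhs : -(β * gammaC P.S P.c P.fc P.fnc xs ls δ η ε) * (etaNorm η (z t - (xs t, ls t))
        - (β⁻¹ * sigmaEta P.S (fun t => (xs t, ls t)) η + √η * ε * Mlam P.S ls lamprior)
          / gammaC P.S P.c P.fc P.fnc xs ls δ η ε)
      = sigmaEta P.S (fun t => (xs t, ls t)) η + β * (√η * ε * Mlam P.S ls lamprior)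
        - β * gammaC P.S P.c P.fc P.fnc xs ls δ η ε * etaNorm η (z t - (xs t, ls t)) := by
    field_simp
    ring
  rw [hrhs]
  rcases (etaNorm_nonneg η (z t - (xs t, ls t))).eq_or_lt with h0 | h0
  · have hmin : IsLocalMin (fun s => etaNorm η (z s - (xs s, ls s))) t :=
      Eventually.of_forall fun s => by
        change etaNorm η (z t - (xs t, ls t)) ≤ _
        rw [← h0]
        exact etaNorm_nonneg _ _
    rw [hmin.deriv_eq_zero, ← h0]
    have : 0 ≤ β * (√η * ε * Mlam P.S ls lamprior) := by positivity
    linarith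
  · have hG := (hasDerivAt_etaNorm hη (hdz.sub_const (xs t, ls t)) h0).add
      (((hasDerivAt_id t).sub_const t).const_mul (sigmaEta P.S (fun t => (xs t, ls t)) η))
    have hle := hasDerivAt_le_of_eventually_le_right hdiff.hasDerivAt hG (by simp) (by
      filter_upwards [Ioo_mem_nhdsGT ht.2] with s hs
      have hsc : s ∈ Icc 0 P.S := ⟨(ht.1.trans hs.1).le, hs.2.le⟩
      have h1 := etaNorm_add_le hη (z s - (xs t, ls t)) ((xs t, ls t) - (xs s, ls s))
      rw [sub_add_sub_cancel, etaNorm_sub_comm hη (xs t, ls t)] at h1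
      exact h1.trans (add_le_add le_rfl (etaNorm_sub_le_sigmaEta hσ htc hsc hs.1)))
    have hin := flow_inner_le hxs hls hδ hβ hη hε hγ htc (hkkt t htc) hw hdx hdl htδ
    have hdiv : (⟪dz.1, (z t - (xs t, ls t)).1⟫ + η⁻¹ * ⟪dz.2, (z t - (xs t, ls t)).2⟫)
        / etaNorm η (z t - (xs t, ls t)) ≤ β * (√η * ε * Mlam P.S ls lamprior)
          - β * gammaC P.S P.c P.fc P.fnc xs ls δ η ε * etaNorm η (z t - (xs t, ls t)) := by
      rw [div_le_iff₀ h0]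
      refine hin.trans_eq ?_
      ring
    linarith

end Tracking

/-- **continuous-time tracking bound.** If
`β⁻¹ σ_η < δ γ(δ,η,ε) − √η ε M_λ` and `ẑ` is a Lipschitz solution of the regularized
primal-dual gradient flow with `‖ẑ(0) − z*(0)‖_η < δ`, then for every `t ∈ [0,S]` the
exponential tracking error bound holds. -/
theorem continuous_tracking_bound {n m : ℕ} (P : Problem n m)
    (xs : ℝ → E n) (ls : ℝ → E m) (hKKT : IsKKTTraj P xs ls)
    (lamprior : E m) (hprior : lamprior ∈ orthant m)
    (hσ : ∀ η : ℝ, 0 < η → 0 < sigmaEta P.S (fun t => (xs t, ls t)) η)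
    (δ β η ε : ℝ) (hδ : 0 < δ) (hβ : 0 < β) (hη : 0 < η) (hε : 0 < ε)
    (hcond : β⁻¹ * sigmaEta P.S (fun t => (xs t, ls t)) η
      < δ * gammaC P.S P.c P.fc P.fnc xs ls δ η ε
        - Real.sqrt η * ε * Mlam P.S ls lamprior)
    (z : ℝ → E n × E m) (hz : IsFlowSol P lamprior β η ε z)
    (hinit : etaNorm η (z 0 - (xs 0, ls 0)) < δ) :
    ∀ t ∈ Icc (0:ℝ) P.S,
      etaNorm η (z t - (xs t, ls t))
        ≤ (β⁻¹ * sigmaEta P.S (fun s => (xs s, ls s)) η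
              + Real.sqrt η * ε * Mlam P.S ls lamprior)
            / gammaC P.S P.c P.fc P.fnc xs ls δ η ε
          + Real.exp (-(β * gammaC P.S P.c P.fc P.fnc xs ls δ η ε) * t)
            * (etaNorm η (z 0 - (xs 0, ls 0))
              - (β⁻¹ * sigmaEta P.S (fun s => (xs s, ls s)) η
                  + Real.sqrt η * ε * Mlam P.S ls lamprior)
                / gammaC P.S P.c P.fc P.fnc xs ls δ η ε) := by
  obtain ⟨⟨⟨K, hK⟩, htraj⟩, hkkt⟩ := hKKT
  obtain ⟨⟨L, hL⟩, hzmem, hflow⟩ := hz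
  have hxs : ContinuousOn xs (Icc 0 P.S) := continuous_fst.comp_continuousOn hK.continuousOn
  have hls : ContinuousOn ls (Icc 0 P.S) := continuous_snd.comp_continuousOn hK.continuousOn
  have hσ' := hσ η hη
  have hM : 0 ≤ Mlam P.S ls lamprior := Real.iSup_nonneg fun _ => norm_nonneg _
  have hb : 0 ≤ √η * ε * Mlam P.S ls lamprior := by positivity
  have hβσ := mul_pos (inv_pos.2 hβ) hσ'
  have hγ : 0 < gammaC P.S P.c P.fc P.fnc xs ls δ η ε :=
    pos_of_mul_pos_right (by linarith) hδ.le
  refine tracking_of_ae_deriv_le (V := fun t => etaNorm η (z t - (xs t, ls t)))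
    (mul_pos hβ hγ).le (lipschitzOnWith_etaNorm hη (hL.sub hK)) hinit
    ((div_lt_iff₀ hγ).2 (by linarith)) ?_
  filter_upwards [(ae_restrict_iff' measurableSet_Icc).1 hflow] with t hdz ht hdiff htδ
  have htc := Ioo_subset_Icc_self ht
  obtain ⟨dz, hdz, hdx, hdl⟩ := hdz htc
  exact deriv_etaNorm_sub_le hxs hls hδ hβ hη hε hσ' hγ hkkt ht (hzmem t htc) hdz hdx hdl hdiff htδ

end TVOpt
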